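/- arXiv:2507.20572 — 3 statements merged into one kernel-verified Lean document; each statement's English description precedes it below -/
import Mathlib

section
/- Let K be a field and let 𝒜 be a non-unital, not necessarily associative algebra over K with elements e, f, g ∈ 𝒜 and scalars i, j, k ∈ K satisfying e·e = i•e, f·f = j•f, g·g = k•g. Set A = e·f, B = e·g, C = f·e, D = f·g, E = g·e, F = g·f. If (x·y)·(x·y) = (x·x)·(y·y) holds for all x, y ∈ 𝒜, then: C·C = (i*j)•C; D·D = (j*k)•D; C·D + D·C = j•(f·(B+E)); j•(C·f) = j•(f·A); and j•(D·f) = j•(f·F). -/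
/-- Polarization of the endo-commutativity identity in its second variable. -/
theorem mul_mul_add_mul_mul_of_endoCommutative {R : Type*} [NonUnitalNonAssocRing R]
    (hec : ∀ x y : R, (x * y) * (x * y) = (x * x) * (y * y)) (x y z : R) :
    (x * y) * (x * z) + (x * z) * (x * y) = (x * x) * (y * z + z * y) := by
  have h := hec x (y + z)
  simp only [mul_add, add_mul, hec x y, hec x z] at h ⊢
  rw [← sub_eq_zero] at h ⊢
  rw [← h]
  abel


/-- The five equations obtained by substituting x = f into the endo-commutativity identity (equation (5)). -/
theorem eq_system_five
    (K : Type*) [Field K] (𝒜 : Type*) [NonUnitalNonAssocRing 𝒜]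
    [Module K 𝒜] [SMulCommClass K 𝒜 𝒜] [IsScalarTower K 𝒜 𝒜]
    (e f g : 𝒜) (i j k : K)
    (he : e * e = i • e) (hf : f * f = j • f) (hg : g * g = k • g)
    (A B C D E F : 𝒜)
    (hA : A = e * f) (hB : B = e * g) (hC : C = f * e)
    (hD : D = f * g) (hE : E = g * e) (hF : F = g * f)
    (hec : ∀ x y : 𝒜, (x * y) * (x * y) = (x * x) * (y * y)) :
    C * C = (i * j) • C ∧
    D * D = (j * k) • D ∧
    C * D + D * C = j • (f * (B + E)) ∧
    j • (C * f) = j • (f * A) ∧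
    j • (D * f) = j • (f * F) := by
  have square (y : 𝒜) (c : K) (hy : y * y = c • y) :
      (f * y) * (f * y) = (c * j) • (f * y) := by
    rw [hec, hf, hy, smul_mul_assoc, mul_smul_comm, smul_smul, mul_comm j c]
  have commute_f (y : 𝒜) : j • ((f * y) * f) = j • (f * (y * f)) := by
    have h := mul_mul_add_mul_mul_of_endoCommutative hec f y f
    simpa only [hf, smul_mul_assoc, mul_smul_comm, mul_add, smul_add, add_left_inj] using h
  subst hA hB hC hD hE hF
  refine ⟨square e i he, ?_, ?_, commute_f e, commute_f g⟩
  · rw [square g k hg, mul_comm k j]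
  · rw [mul_mul_add_mul_mul_of_endoCommutative hec, hf, smul_mul_assoc]
end

section
/- Let K be a field and let 𝒜 be a non-unital, not necessarily associative algebra over K with elements e, f, g ∈ 𝒜 and scalars i, j, k ∈ K satisfying e·e = i•e, f·f = j•f, g·g = k•g. Set A = e·f, B = e·g, C = f·e, D = f·g, E = g·e, F = g·f. If (x·y)·(x·y) = (x·x)·(y·y) holds for all x, y ∈ 𝒜, then: A·A = (i*j)•A; F·F = (j*k)•F; A·F + F·A = j•((B+E)·f); j•(f·A) = j•(C·f); and j•(f·F) = j•(D·f). -/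
/-- Linearization in `x` of the endo-commutativity identity. -/
theorem endoCommutative_polarize {R : Type*} [NonUnitalNonAssocRing R]
    (hec : ∀ x y : R, (x * y) * (x * y) = (x * x) * (y * y)) (u v y : R) :
    (u * y) * (v * y) + (v * y) * (u * y) = (u * v + v * u) * (y * y) := by
  have h := hec (u + v) y
  simp only [add_mul, mul_add, hec u y, hec v y] at h
  rw [add_mul, ← sub_eq_zero]
  rw [← sub_eq_zero] at h
  rw [← h]
  abel

/-- Endo-commutativity linearized at the pair `(x, f)`, for `f * f = j • f`. -/
theorem smul_mul_mul_eq_of_endoCommutative {K R : Type*} [Field K] [NonUnitalNonAssocRing R]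
    [Module K R] [SMulCommClass K R R] [IsScalarTower K R R] {f : R} {j : K}
    (hf : f * f = j • f) (hec : ∀ x y : R, (x * y) * (x * y) = (x * x) * (y * y)) (x : R) :
    j • (f * (x * f)) = j • ((f * x) * f) := by
  have h := endoCommutative_polarize hec x f f
  simpa only [hf, mul_smul_comm, smul_mul_assoc, add_mul, smul_add, add_right_inj] using h

/-- The five equations obtained by substituting y = f into the endo-commutativity identity (equation (8)). -/
theorem eq_system_eight
    (K : Type*) [Field K] (𝒜 : Type*) [NonUnitalNonAssocRing 𝒜]
    [Module K 𝒜] [SMulCommClass K 𝒜 𝒜] [IsScalarTower K 𝒜 𝒜]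
    (e f g : 𝒜) (i j k : K)
    (he : e * e = i • e) (hf : f * f = j • f) (hg : g * g = k • g)
    (A B C D E F : 𝒜)
    (hA : A = e * f) (hB : B = e * g) (hC : C = f * e)
    (hD : D = f * g) (hE : E = g * e) (hF : F = g * f)
    (hec : ∀ x y : 𝒜, (x * y) * (x * y) = (x * x) * (y * y)) :
    A * A = (i * j) • A ∧
    F * F = (j * k) • F ∧
    A * F + F * A = j • ((B + E) * f) ∧
    j • (f * A) = j • (C * f) ∧
    j • (f * F) = j • (D * f) := by
  subst hA hB hC hD hE hF
  refine ⟨?_, ?_, ?_, smul_mul_mul_eq_of_endoCommutative hf hec e,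
    smul_mul_mul_eq_of_endoCommutative hf hec g⟩
  · rw [hec, he, hf, smul_mul_smul_comm]
  · rw [hec, hg, hf, smul_mul_smul_comm, mul_comm k j]
  · rw [endoCommutative_polarize hec, hf, mul_smul_comm]
end

section
/- Let K be a field and let 𝒜 be a non-unital, not necessarily associative algebra over K with elements e, f, g ∈ 𝒜 and scalars i, j, k ∈ K satisfying e·e = i•e, f·f = j•f, g·g = k•g. Set A = e·f, B = e·g, C = f·e, D = f·g, E = g·e, F = g·f. If (x·y)·(x·y) = (x·x)·(y·y) holds for all x, y ∈ 𝒜, then: B·B = (i*k)•B; D·D = (j*k)•D; B·D + D·B = k•((A+C)·g); k•(g·B) = k•(E·g); and k•(g·D) = k•(F·g). -/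
/-- Polarization of the endo-commutativity identity in its first variable. -/
theorem endoCommutative_polarize_left {R : Type*} [NonUnitalNonAssocRing R]
    (hec : ∀ x y : R, (x * y) * (x * y) = (x * x) * (y * y)) (x z y : R) :
    (x * y) * (z * y) + (z * y) * (x * y) = (x * z + z * x) * (y * y) := by
  have h := hec (x + z) y
  simp only [add_mul, mul_add, hec x y, hec z y] at h ⊢
  rw [← sub_eq_zero] at h ⊢
  rw [← h]
  abel


/-- The five equations obtained by substituting y = g into the endo-commutativity identity (equation (9)). -/
theorem eq_system_nine
    (K : Type*) [Field K] (𝒜 : Type*) [NonUnitalNonAssocRing 𝒜]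
    [Module K 𝒜] [SMulCommClass K 𝒜 𝒜] [IsScalarTower K 𝒜 𝒜]
    (e f g : 𝒜) (i j k : K)
    (he : e * e = i • e) (hf : f * f = j • f) (hg : g * g = k • g)
    (A B C D E F : 𝒜)
    (hA : A = e * f) (hB : B = e * g) (hC : C = f * e)
    (hD : D = f * g) (hE : E = g * e) (hF : F = g * f)
    (hec : ∀ x y : 𝒜, (x * y) * (x * y) = (x * x) * (y * y)) :
    B * B = (i * k) • B ∧
    D * D = (j * k) • D ∧
    B * D + D * B = k • ((A + C) * g) ∧
    k • (g * B) = k • (E * g) ∧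
    k • (g * D) = k • (F * g) := by
  subst hA hB hC hD hE hF
  have hcancel : ∀ x : 𝒜, k • (g * (x * g)) = k • ((g * x) * g) := by
    intro x
    have h := endoCommutative_polarize_left hec x g g
    simp only [hg, add_mul, mul_smul_comm, smul_mul_assoc, smul_add] at h
    exact add_left_cancel h
  refine ⟨?_, ?_, ?_, hcancel e, hcancel f⟩
  · rw [hec, he, hg, smul_mul_assoc, mul_smul_comm, smul_smul]
  · rw [hec, hf, hg, smul_mul_assoc, mul_smul_comm, smul_smul]
  · rw [endoCommutative_polarize_left hec, hg, mul_smul_comm]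
end
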